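/- arXiv:2505.13380 — 3 statements merged into one kernel-verified Lean document; each statement's English description precedes it below -/
import Mathlib

section
/- For any three probability density functions p, q, r on a common measure space with respect to a dominating measure m, the squared Hellinger distance satisfies h²((p + r)/2, (q + r)/2) ≤ (1/2) · h²(p, q). -/
open MeasureTheory

noncomputable section

/-- Squared Hellinger distance `h²(p₁, p₂) = (1/2) ∫ (√p₁ − √p₂)² dm` between densities. -/
def hellingerSq {α : Type*} [MeasurableSpace α] (m : Measure α) (p q : α → ℝ) : ℝ :=
  (1 / 2) * ∫ a, (Real.sqrt (p a) - Real.sqrt (q a)) ^ 2 ∂m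

/-- Mixing with a common `r` halves the pointwise squared Hellinger integrand. -/
theorem sqrt_mixture_sub_sq_le {x y r : ℝ} (hx : 0 ≤ x) (hy : 0 ≤ y) (hr : 0 ≤ r) :
    (Real.sqrt ((x + r) / 2) - Real.sqrt ((y + r) / 2)) ^ 2 ≤
      (1 / 2) * (Real.sqrt x - Real.sqrt y) ^ 2 := by
  have hs := Real.sq_sqrt (show 0 ≤ (x + r) / 2 by positivity)
  have ht := Real.sq_sqrt (show 0 ≤ (y + r) / 2 by positivity)
  have hu := Real.sq_sqrt hx
  have hv := Real.sq_sqrt hy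
  have key : (Real.sqrt x * Real.sqrt y + r) / 2 ≤
      Real.sqrt ((x + r) / 2) * Real.sqrt ((y + r) / 2) := by
    refine (abs_le_of_sq_le_sq' ?_ (by positivity)).2
    rw [mul_pow, hs, ht]
    have hxy : (Real.sqrt x * Real.sqrt y) ^ 2 = x * y := by rw [mul_pow, hu, hv]
    nlinarith [mul_nonneg hr (sq_nonneg (Real.sqrt x - Real.sqrt y))]
  nlinarith

/-- The squared Hellinger integrand of two nonnegative integrable functions is integrable. -/
theorem integrable_sqrt_sub_sqrt_sq {α : Type*} [MeasurableSpace α] {m : Measure α}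
    {p q : α → ℝ} (hp0 : ∀ a, 0 ≤ p a) (hq0 : ∀ a, 0 ≤ q a)
    (hp : Integrable p m) (hq : Integrable q m) :
    Integrable (fun a => (Real.sqrt (p a) - Real.sqrt (q a)) ^ 2) m := by
  refine (hp.add hq).mono' ?_ (Filter.Eventually.of_forall fun a => ?_)
  · exact ((Real.continuous_sqrt.comp_aestronglyMeasurable hp.1).sub
      (Real.continuous_sqrt.comp_aestronglyMeasurable hq.1)).pow 2
  · rw [Real.norm_of_nonneg (sq_nonneg _), Pi.add_apply]
    nlinarith [Real.sq_sqrt (hp0 a), Real.sq_sqrt (hq0 a),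
      mul_nonneg (Real.sqrt_nonneg (p a)) (Real.sqrt_nonneg (q a))]

/-- For probability densities `p, q, r` w.r.t. a dominating measure `m`,
`h²((p + r)/2, (q + r)/2) ≤ (1/2) h²(p, q)`. -/
theorem hellinger_mixture_le {α : Type*} [MeasurableSpace α] (m : Measure α)
    (p q r : α → ℝ)
    (hp0 : ∀ a, 0 ≤ p a) (hq0 : ∀ a, 0 ≤ q a) (hr0 : ∀ a, 0 ≤ r a)
    (hpi : Integrable p m) (hqi : Integrable q m) (hri : Integrable r m)
    (hp1 : ∫ a, p a ∂m = 1) (hq1 : ∫ a, q a ∂m = 1) (hr1 : ∫ a, r a ∂m = 1) :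
    hellingerSq m (fun a => (p a + r a) / 2) (fun a => (q a + r a) / 2) ≤
      (1 / 2) * hellingerSq m p q := by
  unfold hellingerSq
  refine le_of_le_of_eq (mul_le_mul_of_nonneg_left (integral_mono_of_nonneg
    (Filter.Eventually.of_forall fun a => sq_nonneg _)
    ((integrable_sqrt_sub_sqrt_sq hp0 hq0 hpi hqi).const_mul (1 / 2))
    (Filter.Eventually.of_forall fun a => sqrt_mixture_sub_sq_le (hp0 a) (hq0 a) (hr0 a)))
    (by norm_num)) ?_
  rw [integral_const_mul]
end
end

section
/- Let (μ₁, ν₁), …, (μ_k, ν_k) be pairwise distinct points in ℝ × (0, ∞), and let f(y | μ, ν) = (2πν)^{-1/2} exp(−(y − μ)²/(2ν)) denote the univariate Gaussian density. Then the 5k functions y ↦ (∂^ρ f / ∂μ^ρ)(y | μ_j, ν_j), for 0 ≤ ρ ≤ 4 and 1 ≤ j ≤ k, are linearly independent over ℝ as functions of y ∈ ℝ. -/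
open Finset

noncomputable section

/-- Univariate Gaussian density with mean `μ` and variance `ν`. -/
def gaussDensity (μ ν y : ℝ) : ℝ :=
  (Real.sqrt (2 * Real.pi * ν))⁻¹ * Real.exp (-((y - μ) ^ 2) / (2 * ν))

open Polynomial Filter Topology

/-- The polynomial `p` such that the `n`-th derivative in the mean of the Gaussian density is
`p (y - μ)` times the density; a rescaled Hermite polynomial. -/
def gaussMeanDerivPoly (ν : ℝ) : ℕ → ℝ[X]
  | 0 => 1
  | n + 1 => C ν⁻¹ * X * gaussMeanDerivPoly ν n - derivative (gaussMeanDerivPoly ν n)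

lemma degree_gaussMeanDerivPoly {ν : ℝ} (hν : ν ≠ 0) (n : ℕ) :
    (gaussMeanDerivPoly ν n).degree = n := by
  induction n with
  | zero => simp [gaussMeanDerivPoly]
  | succ n ih =>
    have h1 : (C ν⁻¹ * X * gaussMeanDerivPoly ν n).degree = ((n + 1 : ℕ) : WithBot ℕ) := by
      rw [degree_mul, ih, degree_C_mul_X (inv_ne_zero hν)]
      push_cast
      exact add_comm _ _
    have h2 : (derivative (gaussMeanDerivPoly ν n)).degree ≤ n := ih ▸ degree_derivative_le
    rw [gaussMeanDerivPoly, degree_sub_eq_left_of_degree_lt, h1]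
    rw [h1]
    exact h2.trans_lt (by exact_mod_cast Nat.lt_succ_self n)

lemma linearIndependent_gaussMeanDerivPoly {ν : ℝ} (hν : ν ≠ 0) :
    LinearIndependent ℝ (gaussMeanDerivPoly ν) :=
  Polynomial.Sequence.linearIndependent
    ⟨gaussMeanDerivPoly ν, degree_gaussMeanDerivPoly hν⟩

lemma hasDerivAt_gaussDensity_mean (ν y t : ℝ) :
    HasDerivAt (fun t => gaussDensity t ν y) (ν⁻¹ * (y - t) * gaussDensity t ν y) t := by
  have h := ((((((hasDerivAt_id t).const_sub y).pow 2).neg).div_const (2 * ν)).exp).const_mul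
    (Real.sqrt (2 * Real.pi * ν))⁻¹
  refine h.congr_deriv ?_
  simp only [gaussDensity, id, Pi.neg_apply, Pi.pow_apply]
  ring

lemma iteratedDeriv_gaussDensity_mean (ν y : ℝ) (n : ℕ) :
    iteratedDeriv n (fun t => gaussDensity t ν y) =
      fun t => (gaussMeanDerivPoly ν n).eval (y - t) * gaussDensity t ν y := by
  induction n with
  | zero => simp [gaussMeanDerivPoly]
  | succ n ih =>
    ext t
    rw [iteratedDeriv_succ, ih]
    have h := (((gaussMeanDerivPoly ν n).hasDerivAt (y - t)).comp t
      ((hasDerivAt_id t).const_sub y)).mul (hasDerivAt_gaussDensity_mean ν y t)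
    refine (h.congr_deriv ?_).deriv
    simp only [gaussMeanDerivPoly, eval_sub, eval_mul, eval_C, eval_X, Function.comp_apply]
    ring

lemma tendsto_eval_mul_exp_linear (p : ℝ[X]) {b : ℝ} (hb : b < 0) :
    Tendsto (fun y => p.eval y * Real.exp (b * y)) atTop (𝓝 0) := by
  have h := (Polynomial.tendsto_div_exp_atTop (p.comp (C (-b)⁻¹ * X))).comp
    (tendsto_id.const_mul_atTop (neg_pos.2 hb))
  refine h.congr fun y => ?_
  have : -b ≠ 0 := by linarith
  simp only [Function.comp_apply, id, eval_comp, eval_mul, eval_C, eval_X,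
    inv_mul_cancel_left₀ this]
  rw [div_eq_mul_inv, ← Real.exp_neg]
  ring_nf

/-- A polynomial times the exponential of a quadratic tends to zero when the quadratic has
lexicographically negative coefficients. -/
lemma tendsto_eval_mul_exp_quadratic (p : ℝ[X]) {a b : ℝ} (hab : a < 0 ∨ a = 0 ∧ b < 0) :
    Tendsto (fun y => p.eval y * Real.exp (a * y ^ 2 + b * y)) atTop (𝓝 0) := by
  rcases hab with ha | ⟨rfl, hb⟩
  · have h1 : Tendsto (fun y : ℝ => (a * y + (b + 1)) * y) atTop atBot :=
      (tendsto_atBot_add_const_right _ _ (tendsto_id.const_mul_atTop_of_neg ha)).atBot_mul_atTop₀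
        tendsto_id
    have h := (tendsto_eval_mul_exp_linear p (b := -1) (by norm_num)).mul
      (Real.tendsto_exp_atBot.comp h1)
    rw [mul_zero] at h
    refine h.congr fun y => ?_
    rw [Function.comp_apply, mul_assoc, ← Real.exp_add]
    ring_nf
  · simpa using tendsto_eval_mul_exp_linear p hb

/-- Exponentials of distinct quadratics without constant term are linearly independent over
the polynomials. -/
lemma eq_zero_of_sum_eval_mul_exp_quadratic {ι : Type*} [Fintype ι] (a b : ι → ℝ)
    (hab : Function.Injective fun j => (a j, b j)) (p : ι → ℝ[X])
    (h : ∀ y : ℝ, ∑ j, (p j).eval y * Real.exp (a j * y ^ 2 + b j * y) = 0) :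
    ∀ j, p j = 0 := by
  classical
  by_contra! hne
  obtain ⟨i, hi⟩ := hne
  obtain ⟨m, hm, hmax⟩ := exists_max_image (univ.filter fun j => p j ≠ 0)
    (fun j => toLex (a j, b j)) ⟨i, by simpa using hi⟩
  simp only [mem_filter, mem_univ, true_and] at hm hmax
  have hlim : Tendsto (fun y => ∑ j ∈ univ.erase m,
      (p j).eval y * Real.exp ((a j - a m) * y ^ 2 + (b j - b m) * y)) atTop (𝓝 0) := by
    rw [← sum_const_zero (s := univ.erase m)]
    refine tendsto_finsetSum _ fun j hj => ?_
    by_cases hpj : p j = 0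
    · simp [hpj]
    apply tendsto_eval_mul_exp_quadratic
    have hlt : toLex (a j, b j) < toLex (a m, b m) :=
      lt_of_le_of_ne (hmax j hpj) fun he => (mem_erase.1 hj).1 (hab (toLex.injective he))
    rcases Prod.Lex.toLex_lt_toLex.1 hlt with h1 | ⟨h1, h2⟩
    · exact Or.inl (sub_neg.2 h1)
    · exact Or.inr ⟨sub_eq_zero.2 h1, sub_neg.2 h2⟩
  have hpm : Tendsto (fun y => (p m).eval y) atTop (𝓝 0) := by
    rw [← neg_zero]
    refine hlim.neg.congr fun y => ?_
    have hy : ∑ j, (p j).eval y * Real.exp ((a j - a m) * y ^ 2 + (b j - b m) * y) = 0 := by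
      rw [← zero_mul (Real.exp (-(a m * y ^ 2 + b m * y))), ← h y, sum_mul]
      refine sum_congr rfl fun j _ => ?_
      rw [mul_assoc, ← Real.exp_add]
      ring_nf
    rw [← add_sum_erase _ _ (mem_univ m)] at hy
    simp only [sub_self, zero_mul, add_zero, Real.exp_zero, mul_one] at hy
    linarith
  exact hm (leadingCoeff_eq_zero.1 ((tendsto_nhds_iff _).1 hpm).1)

/-- For pairwise distinct `(μ_j, ν_j) ∈ ℝ × (0, ∞)`, the functions
`y ↦ ∂^ρ f/∂μ^ρ (y | μ_j, ν_j)` for `0 ≤ ρ ≤ 4`, `1 ≤ j ≤ k` are linearly independent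
over `ℝ` as functions of `y ∈ ℝ`. -/
theorem gaussian_mean_derivatives_linearIndependent
    (k : ℕ) (μ ν : Fin k → ℝ) (hν : ∀ j, 0 < ν j)
    (hdist : Function.Injective fun j => (μ j, ν j))
    (a : Fin k → Fin 5 → ℝ)
    (h : ∀ y : ℝ,
      ∑ j, ∑ ρ : Fin 5,
        a j ρ * iteratedDeriv (ρ : ℕ) (fun t => gaussDensity t (ν j) y) (μ j) = 0) :
    ∀ j ρ, a j ρ = 0 := by
  set q : Fin k → ℝ[X] := fun j => ∑ ρ : Fin 5, C (a j ρ) * gaussMeanDerivPoly (ν j) ρ with hq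
  set c : Fin k → ℝ := fun j =>
    (Real.sqrt (2 * Real.pi * ν j))⁻¹ * Real.exp (-(μ j ^ 2 / (2 * ν j))) with hc
  have hcne : ∀ j, c j ≠ 0 := fun j => by
    have := hν j
    positivity
  have hinj : Function.Injective fun j => (-(2 * ν j)⁻¹, μ j / ν j) := by
    intro i j hij
    simp only [Prod.mk.injEq, neg_inj, inv_inj] at hij
    have h1 : ν i = ν j := by linarith [hij.1]
    have h2 : μ i = μ j := by
      rw [h1] at hij
      exact (div_left_inj' (hν j).ne').1 hij.2
    exact hdist (Prod.ext h2 h1)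
  have hzero := eq_zero_of_sum_eval_mul_exp_quadratic _ _ hinj
    (fun j => C (c j) * (q j).comp (X - C (μ j))) fun y => by
      rw [← h y]
      refine sum_congr rfl fun j _ => ?_
      have hg : gaussDensity (μ j) (ν j) y =
          c j * Real.exp (-(2 * ν j)⁻¹ * y ^ 2 + μ j / ν j * y) := by
        simp only [gaussDensity, hc]
        rw [mul_assoc (Real.sqrt _)⁻¹, ← Real.exp_add]
        have := (hν j).ne'
        congr 2
        field_simp
        ring
      simp only [iteratedDeriv_gaussDensity_mean, hg, hq, eval_mul, eval_C, eval_comp, eval_sub,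
        eval_X, eval_finsetSum, mul_sum, sum_mul]
      exact sum_congr rfl fun ρ _ => by ring
  intro j
  have hqj : q j = 0 := by
    have h0 := (mul_eq_zero.1 (hzero j)).resolve_left (C_ne_zero.2 (hcne j))
    refine (comp_eq_zero_iff.1 h0).resolve_right fun h1 => ?_
    have h2 := congrArg natDegree h1.2
    rw [natDegree_X_sub_C, natDegree_C] at h2
    exact one_ne_zero h2
  have hli := (linearIndependent_gaussMeanDerivPoly (hν j).ne').comp _
    (Fin.val_injective (n := 5))
  refine Fintype.linearIndependent_iff.1 hli (a j) ?_
  simpa [hq, smul_eq_C_mul] using hqj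
end
end

section
/- Let a ∈ ℝ^d with a ≠ 0 and b ∈ ℝ, and let σ(z) = 1/(1 + e^{−z}) denote the sigmoid. Then the functions of X ∈ ℝ^d given by the constant 1, the coordinates X^{(u)} (1 ≤ u ≤ d), σ(aᵀX + b), X^{(u)} σ(aᵀX + b) (1 ≤ u ≤ d), and X^{(u)} X^{(v)} σ(aᵀX + b) (1 ≤ u ≤ v ≤ d) are linearly independent: any real linear combination of them that vanishes for almost every X ∈ ℝ^d has all coefficients zero. -/
open MeasureTheory Finset

noncomputable section

/-- The sigmoid function `σ(z) = 1/(1 + e^{−z})`. -/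
def sigmoid (z : ℝ) : ℝ := (1 + Real.exp (-z))⁻¹

/-- Real polynomials `p`, `q` with `p + k e^{-t} q = 0` on the line, `k ≠ 0`, are both zero. -/
lemma Polynomial.eq_zero_of_eval_add_eval_mul_exp_neg {p q : Polynomial ℝ} {k : ℝ} (hk : k ≠ 0)
    (h : ∀ t : ℝ, p.eval t + q.eval t * (k * Real.exp (-t)) = 0) : p = 0 ∧ q = 0 := by
  have hp : p = 0 := by
    have hlim : Filter.Tendsto (fun t => p.eval t) Filter.atTop (nhds 0) := by
      have hq := (Polynomial.tendsto_div_exp_atTop q).const_mul (-k)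
      rw [mul_zero] at hq
      refine hq.congr fun t => ?_
      have ht := h t
      rw [Real.exp_neg] at ht
      rw [div_eq_mul_inv]
      linarith
    exact Polynomial.leadingCoeff_eq_zero.mp ((Polynomial.tendsto_nhds_iff p).mp hlim).1
  refine ⟨hp, Polynomial.funext fun t => ?_⟩
  simpa [hp, hk, Real.exp_ne_zero] using h t

lemma sigmoid_continuous : Continuous sigmoid := by
  unfold sigmoid
  exact Continuous.inv₀ (by fun_prop) fun z => by positivity

lemma eq_zero_of_affine_eq_zero {d : ℕ} {c0 : ℝ} {c1 : Fin d → ℝ}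
    (h : ∀ x : Fin d → ℝ, c0 + ∑ u, c1 u * x u = 0) : c0 = 0 ∧ ∀ u, c1 u = 0 := by
  have h0 : c0 = 0 := by simpa using h 0
  exact ⟨h0, fun u => by simpa [h0, Pi.single_apply] using h (Pi.single u 1)⟩

lemma eq_zero_of_quadratic_eq_zero {d : ℕ} {c2 : ℝ} {c3 : Fin d → ℝ} {c4 : Fin d → Fin d → ℝ}
    (h : ∀ x : Fin d → ℝ, c2 + (∑ u, c3 u * x u) +
      (∑ u, ∑ v, if u ≤ v then c4 u v * x u * x v else 0) = 0) :
    c2 = 0 ∧ (∀ u, c3 u = 0) ∧ ∀ u v, u ≤ v → c4 u v = 0 := by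
  have h2 : c2 = 0 := by simpa using h 0
  let B : Fin d → Fin d → ℝ := fun u v => if u ≤ v then c4 u v else 0
  have hB (x : Fin d → ℝ) : (∑ u, c3 u * x u) + ∑ u, ∑ v, B u v * x u * x v = 0 := by
    simpa [B, h2, ite_mul] using h x
  have hpos (u) : c3 u + B u u = 0 := by
    simpa [Pi.single_apply] using hB (Pi.single u 1)
  have hneg (u) : -c3 u + B u u = 0 := by
    simpa [Pi.single_apply] using hB (-Pi.single u 1)
  have h3 (u) : c3 u = 0 := by linarith [hpos u, hneg u]
  have hdiag (u) : B u u = 0 := by linarith [hpos u, hneg u]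
  refine ⟨h2, h3, fun u v huv => ?_⟩
  rcases huv.eq_or_lt with rfl | hlt
  · simpa [B] using hdiag u
  · have hsum := hB (Pi.single u 1 + Pi.single v 1)
    simp only [h3, Pi.add_apply, Pi.single_apply, mul_add, Finset.sum_add_distrib,
      mul_ite, mul_one, mul_zero, Finset.sum_ite_eq', Finset.mem_univ,
      if_true, zero_add, hdiag] at hsum
    simpa [B, hlt.le, hlt.not_ge, hdiag] using hsum

/-- For `a ≠ 0`, the functions `1`, `X^{(u)}`, `σ(aᵀX + b)`,
`X^{(u)} σ(aᵀX + b)` and `X^{(u)} X^{(v)} σ(aᵀX + b)` (`u ≤ v`) of `X ∈ ℝ^d` are linearly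
independent: any real linear combination vanishing for almost every `X` has all
coefficients zero. -/
theorem sigmoid_family_linearIndependent
    (d : ℕ) (a : EuclideanSpace ℝ (Fin d)) (ha : a ≠ 0) (b : ℝ)
    (c0 : ℝ) (c1 : Fin d → ℝ) (c2 : ℝ) (c3 : Fin d → ℝ) (c4 : Fin d → Fin d → ℝ)
    (h : ∀ᵐ x ∂(volume : Measure (EuclideanSpace ℝ (Fin d))),
      c0 + (∑ u, c1 u * x u) + c2 * sigmoid ((∑ u, a u * x u) + b) +
        (∑ u, c3 u * x u * sigmoid ((∑ u', a u' * x u') + b)) +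
        (∑ u, ∑ v, if u ≤ v then
            c4 u v * x u * x v * sigmoid ((∑ u', a u' * x u') + b) else 0) = 0) :
    c0 = 0 ∧ (∀ u, c1 u = 0) ∧ c2 = 0 ∧ (∀ u, c3 u = 0) ∧
      ∀ u v, u ≤ v → c4 u v = 0 := by
  let L : (Fin d → ℝ) → ℝ := fun x => c0 + ∑ u, c1 u * x u
  let Q : (Fin d → ℝ) → ℝ := fun x => c2 + (∑ u, c3 u * x u) +
    ∑ u, ∑ v, if u ≤ v then c4 u v * x u * x v else 0
  have hcont : Continuous fun x : EuclideanSpace ℝ (Fin d) =>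
      L x + Q x * sigmoid ((∑ u, a u * x u) + b) := by
    have hs : Continuous fun x : EuclideanSpace ℝ (Fin d) => sigmoid ((∑ u, a u * x u) + b) :=
      sigmoid_continuous.comp (by fun_prop)
    have hQ : Continuous fun x : EuclideanSpace ℝ (Fin d) => Q x := by
      refine Continuous.add (by fun_prop) (continuous_finsetSum _ fun u _ =>
        continuous_finsetSum _ fun v _ => ?_)
      split_ifs <;> fun_prop
    exact Continuous.add (by fun_prop) (hQ.mul hs)
  have hzero : (fun x : EuclideanSpace ℝ (Fin d) =>
      L x + Q x * sigmoid ((∑ u, a u * x u) + b)) = fun _ => 0 := by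
    refine (hcont.ae_eq_iff_eq volume continuous_const).mp ?_
    filter_upwards [h] with x hx
    rw [← hx]
    simp only [L, Q, add_mul, Finset.sum_mul, ite_mul, zero_mul]
    ring
  obtain ⟨w, hw⟩ : ∃ w : Fin d → ℝ, ∑ u, a u * w u = 1 := by
    obtain ⟨i, hi⟩ : ∃ i, a i ≠ 0 := by
      by_contra! hall
      exact ha (PiLp.ext hall)
    exact ⟨Pi.single i (a i)⁻¹, by simp [Pi.single_apply, hi]⟩
  have hLQ (y : Fin d → ℝ) : L y = 0 ∧ Q y = 0 := by
    let ℓ : Fin d → Polynomial ℝ := fun u => Polynomial.C (y u) + Polynomial.C (w u) * Polynomial.X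
    let p : Polynomial ℝ := Polynomial.C c0 + ∑ u, Polynomial.C (c1 u) * ℓ u
    let q : Polynomial ℝ := Polynomial.C c2 + (∑ u, Polynomial.C (c3 u) * ℓ u) +
      ∑ u, ∑ v, if u ≤ v then Polynomial.C (c4 u v) * ℓ u * ℓ v else 0
    have hp (t : ℝ) : p.eval t = L (fun u => y u + w u * t) := by
      simp [p, ℓ, L, Polynomial.eval_finsetSum]
    have hq (t : ℝ) : q.eval t = Q (fun u => y u + w u * t) := by
      simp [q, ℓ, Q, Polynomial.eval_finsetSum, apply_ite (Polynomial.eval t)]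
    have hpq : p + q = 0 ∧ p = 0 := by
      refine Polynomial.eq_zero_of_eval_add_eval_mul_exp_neg
        (Real.exp_ne_zero (-((∑ u, a u * y u) + b))) fun t => ?_
      have hline := congrFun hzero (WithLp.toLp 2 fun u => y u + w u * t)
      have harg : (∑ u, a u * (y u + w u * t)) + b = ((∑ u, a u * y u) + b) + t := by
        simp only [mul_add, Finset.sum_add_distrib, ← mul_assoc, ← Finset.sum_mul, hw]
        ring
      simp only [harg, sigmoid] at hline
      rw [← hp, ← hq, neg_add, Real.exp_add] at hline
      rw [Polynomial.eval_add]
      field_simp at hline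
      linarith
    have hq0 : q = 0 := by simpa [hpq.2] using hpq.1
    have hp' := hp 0
    have hq' := hq 0
    rw [hpq.2] at hp'
    rw [hq0] at hq'
    simp only [Polynomial.eval_zero, mul_zero, add_zero] at hp' hq'
    exact ⟨hp'.symm, hq'.symm⟩
  obtain ⟨h0, h1⟩ := eq_zero_of_affine_eq_zero fun x => (hLQ x).1
  exact ⟨h0, h1, eq_zero_of_quadratic_eq_zero fun x => (hLQ x).2⟩
end
end
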